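/- Let ε > 0 be real, M ≥ 1 an integer, and ψ ∈ (0, 2π). Then the set of complex roots of the polynomial (x − iε)^M − e^{iψ}·(x + iε)^M is exactly { −ε·cot((ψ + 2πk)/(2M)) : k = 0, 1, …, M−1 }, and these M values are real and pairwise distinct. -/

import Mathlib

open Real

theorem Real.cot_injOn : Set.InjOn Real.cot (Set.Ioo 0 π) := by
  intro a ha b hb hab
  have hsa := (sin_pos_of_mem_Ioo ha).ne'
  have hsb := (sin_pos_of_mem_Ioo hb).ne'
  simp only [Real.cot_eq_cos_div_sin] at hab
  rw [div_eq_div_iff hsa hsb] at hab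
  have h : sin (a - b) = 0 := by rw [sin_sub]; linarith
  have := (sin_eq_zero_iff_of_lt_of_lt (by linarith [ha.1, hb.2]) (by linarith [ha.2, hb.1])).1 h
  linarith

/-- The Cayley transform `x ↦ (x - iε) / (x + iε)` takes the value `exp (2iθ)` exactly at
`x = -ε cot θ`. -/
theorem sub_I_mul_eq_exp_mul_add_I_mul_iff (ε θ : ℝ) (hθ : sin θ ≠ 0) (x : ℂ) :
    x - Complex.I * ε = Complex.exp (2 * θ * Complex.I) * (x + Complex.I * ε) ↔
      x = ((-(ε * Real.cot θ) : ℝ) : ℂ) := by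
  have hs : Complex.sin θ ≠ 0 := by exact_mod_cast hθ
  have hexp : Complex.exp (2 * θ * Complex.I) =
      1 + 2 * Complex.I * Complex.sin θ * Complex.exp (θ * Complex.I) := by
    rw [Complex.exp_mul_I, Complex.exp_mul_I, Complex.cos_two_mul, Complex.sin_two_mul]
    linear_combination 2 * Complex.sin_sq_add_cos_sq (θ : ℂ) -
      2 * Complex.sin (θ : ℂ) ^ 2 * Complex.I_sq
  have hfactor : x - Complex.I * ε - Complex.exp (2 * θ * Complex.I) * (x + Complex.I * ε) =
      -2 * Complex.I * Complex.exp (θ * Complex.I) *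
        (x * Complex.sin θ + ε * Complex.cos θ) := by
    have hmul : (Complex.cos θ - Complex.I * Complex.sin θ) * Complex.exp (θ * Complex.I) = 1 := by
      rw [Complex.exp_mul_I]
      linear_combination Complex.sin_sq_add_cos_sq (θ : ℂ) -
        Complex.sin (θ : ℂ) ^ 2 * Complex.I_sq
    rw [hexp]
    linear_combination 2 * Complex.I * ε * hmul
  rw [← sub_eq_zero, hfactor, mul_eq_zero, or_iff_right (by simp)]
  push_cast
  rw [Complex.cot_eq_cos_div_sin]
  constructor
  · intro h
    field_simp
    linear_combination h
  · rintro rfl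
    field_simp
    ring

/-- The `M` solutions of `w ^ M = exp (iψ)`. -/
theorem Complex.pow_eq_exp_I_mul_iff {M : ℕ} (hM : M ≠ 0) (ψ : ℝ) (w : ℂ) :
    w ^ M = Complex.exp (Complex.I * ψ) ↔
      ∃ k < M, w =
        Complex.exp (2 * ((ψ + 2 * π * (k : ℝ)) / (2 * M) : ℝ) * Complex.I) := by
  have hMC : (M : ℂ) ≠ 0 := by exact_mod_cast hM
  have hsplit (k : ℕ) :
      Complex.exp (2 * ((ψ + 2 * π * (k : ℝ)) / (2 * M) : ℝ) * Complex.I) =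
        Complex.exp (2 * π * Complex.I / M) ^ k * Complex.exp (Complex.I * ψ / M) := by
    rw [← Complex.exp_nat_mul, ← Complex.exp_add]
    congr 1
    push_cast
    field_simp
    ring
  have hroot : Complex.exp (Complex.I * ψ / M) ^ M = Complex.exp (Complex.I * ψ) := by
    rw [← Complex.exp_nat_mul]
    congr 1
    field_simp
  have hprim := Complex.isPrimitiveRoot_exp M hM
  have : NeZero M := ⟨hM⟩
  simp only [hsplit]
  constructor
  · intro h
    obtain ⟨k, hk, hw⟩ := hprim.eq_pow_of_pow_eq_one
      (ξ := w / Complex.exp (Complex.I * ψ / M))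
      (by rw [div_pow, hroot, h, div_self (Complex.exp_ne_zero _)])
    exact ⟨k, hk, by rw [hw, div_mul_cancel₀ _ (Complex.exp_ne_zero _)]⟩
  · rintro ⟨k, -, rfl⟩
    rw [mul_pow, hroot, pow_right_comm, hprim.pow_eq_one, one_pow, one_mul]

/-- for real `ε > 0`, integer `M ≥ 1` and `ψ ∈ (0, 2π)`, the complex
roots of `(x − iε)^M − e^{iψ}·(x + iε)^M` are exactly the `M` real, pairwise
distinct values `−ε·cot((ψ + 2πk)/(2M))`, `k = 0, …, M−1`. -/
theorem roots_of_twisted_high_temperature_equation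
    (ε : ℝ) (hε : 0 < ε) (M : ℕ) (hM : 1 ≤ M) (ψ : ℝ) (hψ : ψ ∈ Set.Ioo 0 (2 * π)) :
    (∀ x : ℂ,
      (x - Complex.I * (ε : ℂ)) ^ M - Complex.exp (Complex.I * (ψ : ℂ)) *
          (x + Complex.I * (ε : ℂ)) ^ M = 0 ↔
        ∃ k < M, x = ((-(ε * Real.cot ((ψ + 2 * π * (k : ℝ)) / (2 * M))) : ℝ) : ℂ)) ∧
    Function.Injective
      (fun k : Fin M => -(ε * Real.cot ((ψ + 2 * π * (k : ℝ)) / (2 * M)))) := by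
  have hM0 : M ≠ 0 := Nat.one_le_iff_ne_zero.1 hM
  have hMpos : (0 : ℝ) < M := by exact_mod_cast hM
  have hangle (k : ℕ) (hk : k < M) : (ψ + 2 * π * (k : ℝ)) / (2 * M) ∈ Set.Ioo 0 π := by
    have hk' : (k : ℝ) + 1 ≤ M := by exact_mod_cast hk
    have hψ0 := hψ.1
    refine ⟨by positivity, ?_⟩
    rw [div_lt_iff₀ (by positivity)]
    nlinarith [hψ.2, pi_pos]
  refine ⟨fun x ↦ ?_, fun j k hjk ↦ ?_⟩
  · by_cases hx : x + Complex.I * ε = 0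
    · have hne (θ : ℝ) : x ≠ (θ : ℂ) := by
        rintro rfl
        have := congrArg Complex.im hx
        simp [hε.ne'] at this
      have hx' : x - Complex.I * ε ≠ 0 := by
        intro h
        have : x = ((0 : ℝ) : ℂ) := by push_cast; linear_combination (h + hx) / 2
        exact hne 0 this
      simp [hx, hM0, hx', hne, -Complex.ofReal_neg, -Complex.ofReal_mul]
    · rw [sub_eq_zero, ← div_eq_iff (pow_ne_zero M hx), ← div_pow,
        Complex.pow_eq_exp_I_mul_iff hM0]
      refine exists_congr fun k ↦ and_congr_right fun hk ↦ ?_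
      rw [div_eq_iff hx, sub_I_mul_eq_exp_mul_add_I_mul_iff ε _
        (sin_pos_of_mem_Ioo (hangle k hk)).ne']
  · have hcot := mul_left_cancel₀ hε.ne' (neg_injective hjk)
    have h := Real.cot_injOn (hangle j j.2) (hangle k k.2) hcot
    rw [div_left_inj' (by positivity), add_right_inj,
      mul_right_inj' (by positivity)] at h
    exact Fin.ext (by exact_mod_cast h)
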